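/- Let Γ = (a,b)×(c,d) ⊂ ℝ² and u ∈ L∞(Γ), f ∈ L¹(Γ), with ∬_Γ (u φ_X + f φ) dX dY = 0 for all φ ∈ C_c^∞(Γ). Then after modifying u on a null set, for a.e. Y₀ ∈ (c,d) the map X ↦ u(X,Y₀) is absolutely continuous on (a,b) with ∂u/∂X(X,Y₀) = f(X,Y₀) for a.e. X ∈ (a,b). -/

import Mathlib

open MeasureTheory

lemma aux_int_mul {k : ℝ × ℝ → ℝ} (hk : Integrable k) {h ψ : ℝ → ℝ}
    (hh : Continuous h) (hhc : HasCompactSupport h) (hψ : Continuous ψ)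
    (hψc : HasCompactSupport ψ) : Integrable (fun p => k p * (h p.1 * ψ p.2)) := by
  obtain ⟨C, hC⟩ := hhc.exists_bound_of_continuous hh
  obtain ⟨D, hD⟩ := hψc.exists_bound_of_continuous hψ
  refine hk.mul_bdd (c := C * D) (by fun_prop) (Filter.Eventually.of_forall fun p => ?_)
  rw [norm_mul]
  exact mul_le_mul (hC _) (hD _) (norm_nonneg _) ((norm_nonneg _).trans (hC p.1))

lemma aux_ibp {k : ℝ → ℝ} (hk : Integrable k) {Φ : ℝ → ℝ} (hΦ : ContDiff ℝ 1 Φ)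
    (hc : HasCompactSupport Φ) :
    ∫ x, (∫ s in Set.Iic x, k s) * deriv Φ x = - ∫ s, k s * Φ s := by
  have hd : Integrable (deriv Φ) :=
    (hΦ.continuous_deriv le_rfl).integrable_of_hasCompactSupport hc.deriv
  have hint : Integrable (fun p : ℝ × ℝ => {p : ℝ × ℝ | p.2 ≤ p.1}.indicator
      (fun p => deriv Φ p.1 * k p.2) p) (volume.prod volume) :=
    (hd.mul_prod hk).indicator (measurableSet_le measurable_snd measurable_fst)
  have e1 : ∀ x, (∫ s in Set.Iic x, k s) * deriv Φ x =
      ∫ s, {p : ℝ × ℝ | p.2 ≤ p.1}.indicator (fun p => deriv Φ p.1 * k p.2) (x, s) := by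
    intro x
    rw [← integral_indicator measurableSet_Iic, mul_comm, ← integral_const_mul]
    congr 1
    ext s
    by_cases hs : s ≤ x <;> simp [Set.indicator, hs]
  have e2 : ∀ s, ∫ x, {p : ℝ × ℝ | p.2 ≤ p.1}.indicator (fun p => deriv Φ p.1 * k p.2) (x, s)
      = - (k s * Φ s) := by
    intro s
    have : ∫ x in Set.Ioi s, deriv Φ x = - Φ s := hc.integral_Ioi_deriv_eq hΦ s
    rw [← integral_Ici_eq_integral_Ioi, ← integral_indicator measurableSet_Ici] at this
    rw [← mul_neg, ← this, ← integral_const_mul]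
    congr 1
    ext x
    by_cases hs : s ≤ x <;> simp [Set.indicator, hs, mul_comm]
  simp_rw [e1]
  rw [integral_integral_swap (f := fun x s => {p : ℝ × ℝ | p.2 ≤ p.1}.indicator
      (fun p => deriv Φ p.1 * k p.2) (x, s)) hint]
  simp_rw [e2]
  rw [integral_neg]

lemma aux_prim {a b : ℝ} (hab : a < b) {h : ℝ → ℝ} (hh : ContDiff ℝ (⊤ : ℕ∞) h)
    (hc : HasCompactSupport h) (hs : tsupport h ⊆ Set.Ioo a b) (h0 : ∫ x, h x = 0) :
    ∃ Φ : ℝ → ℝ, ContDiff ℝ (⊤ : ℕ∞) Φ ∧ HasCompactSupport Φ ∧ tsupport Φ ⊆ Set.Ioo a b ∧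
      deriv Φ = h := by
  obtain ⟨p, q, hap, hqb, hpq⟩ : ∃ p q, a < p ∧ q < b ∧ tsupport h ⊆ Set.Icc p q := by
    rcases (tsupport h).eq_empty_or_nonempty with he | hne
    · exact ⟨b, a, hab, hab, by simp [he]⟩
    · obtain ⟨p, hp⟩ := hc.isCompact.exists_isLeast hne
      obtain ⟨q, hq⟩ := hc.isCompact.exists_isGreatest hne
      exact ⟨p, q, (hs hp.1).1, (hs hq.1).2, fun x hx => ⟨hp.2 hx, hq.2 hx⟩⟩
  have hi : Integrable h := hh.continuous.integrable_of_hasCompactSupport hc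
  have hz : ∀ x, x ∉ Set.Icc p q → h x = 0 := fun x hx =>
    image_eq_zero_of_notMem_tsupport fun h' => hx (hpq h')
  let Φ : ℝ → ℝ := fun x => ∫ s in p..x, h s
  have hder : ∀ x, HasDerivAt Φ (h x) x := fun x =>
    intervalIntegral.integral_hasDerivAt_right hi.intervalIntegrable
      hh.continuous.aestronglyMeasurable.stronglyMeasurableAtFilter hh.continuous.continuousAt
  have hderiv : deriv Φ = h := funext fun x => (hder x).deriv
  have hsupp : Function.support Φ ⊆ Set.Icc p q := by
    intro x hx
    by_contra hxn
    apply hx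
    show ∫ s in p..x, h s = 0
    by_cases hxp : x < p
    · rw [intervalIntegral.integral_symm, neg_eq_zero, intervalIntegral.integral_of_le hxp.le,
        integral_Ioc_eq_integral_Ioo]
      exact setIntegral_eq_zero_of_forall_eq_zero fun s hs' => hz s fun h' => by
        have := h'.1; have := hs'.2; linarith
    · have hpx : p ≤ x := not_lt.1 hxp
      have hqx : q < x := by
        by_contra hq; exact hxn ⟨hpx, not_lt.1 hq⟩
      rw [intervalIntegral.integral_of_le hpx, ← integral_Icc_eq_integral_Ioc,
        setIntegral_eq_integral_of_forall_compl_eq_zero, h0]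
      intro s hs'
      exact hz s fun h' => hs' ⟨h'.1, h'.2.trans hqx.le⟩
  refine ⟨Φ, ?_, HasCompactSupport.of_support_subset_isCompact isCompact_Icc hsupp, ?_, hderiv⟩
  · rw [contDiff_infty_iff_deriv, hderiv]
    exact ⟨fun x => (hder x).differentiableAt, hh⟩
  · exact (closure_minimal hsupp isClosed_Icc).trans fun x hx =>
      ⟨hap.trans_le hx.1, hx.2.trans_lt hqb⟩

lemma aux_C {a b c d : ℝ} {z : ℝ × ℝ → ℝ} (hz : Integrable z)
    (hz0 : ∀ p, p ∉ Set.Ioo a b ×ˢ Set.Ioo c d → z p = 0)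
    (H : ∀ h ψ : ℝ → ℝ, ContDiff ℝ (⊤ : ℕ∞) h → HasCompactSupport h → tsupport h ⊆ Set.Ioo a b →
      ContDiff ℝ (⊤ : ℕ∞) ψ → HasCompactSupport ψ → tsupport ψ ⊆ Set.Ioo c d →
      ∫ p, z p * (h p.1 * ψ p.2) = 0) : z =ᵐ[volume] 0 := by
  have hz' : Integrable z (volume.prod volume) := hz
  -- step 1
  have s1 : ∀ ψ : ℝ → ℝ, ContDiff ℝ (⊤ : ℕ∞) ψ → HasCompactSupport ψ → tsupport ψ ⊆ Set.Ioo c d →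
      ∀ᵐ x, ∫ y, z (x, y) * ψ y = 0 := by
    intro ψ h1 h2 h3
    obtain ⟨D, hD⟩ := h2.exists_bound_of_continuous h1.continuous
    have hc := h1.continuous
    have hi : Integrable (fun p : ℝ × ℝ => z p * ψ p.2) (volume.prod volume) :=
      hz'.mul_bdd (c := D) (by fun_prop) (Filter.Eventually.of_forall fun p => hD _)
    have := isOpen_Ioo.ae_eq_zero_of_integral_contDiff_smul_eq_zero (U := Set.Ioo a b)
      (f := fun x => ∫ y, z (x, y) * ψ y) (μ := volume)
      (hi.integral_prod_left.locallyIntegrable.locallyIntegrableOn _) (by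
        intro h g1 g2 g3
        rw [← H h ψ g1 g2 g3 h1 h2 h3, Measure.volume_eq_prod,
          integral_prod _ (aux_int_mul hz g1.continuous g2 hc h2)]
        congr 1; ext x
        rw [smul_eq_mul, ← integral_const_mul]
        congr 1; ext y; ring)
    filter_upwards [this] with x hx
    by_cases hxI : x ∈ Set.Ioo a b
    · exact hx hxI
    · have : ∀ y, z (x, y) * ψ y = 0 := fun y => by
        rw [hz0 _ (fun h => hxI h.1), zero_mul]
      simp [this]
  have s2 : ∀ A : Set ℝ, MeasurableSet A → ∀ᵐ y, ∫ x in A, z (x, y) = 0 := by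
    intro A hA
    have hzA : Integrable z ((volume.restrict A).prod volume) := by
      have : (volume.restrict A).prod (volume : Measure ℝ) =
          (volume.prod volume).restrict (A ×ˢ Set.univ) := by
        rw [← Measure.prod_restrict, Measure.restrict_univ]
      rw [this]; exact hz'.restrict
    have := isOpen_Ioo.ae_eq_zero_of_integral_contDiff_smul_eq_zero (U := Set.Ioo c d)
      (f := fun y => ∫ x in A, z (x, y)) (μ := volume)
      (hzA.integral_prod_right.locallyIntegrable.locallyIntegrableOn _) (by
        intro ψ g1 g2 g3
        obtain ⟨D, hD⟩ := g2.exists_bound_of_continuous g1.continuous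
        have hc := g1.continuous
        have hi : Integrable (fun p : ℝ × ℝ => z p * ψ p.2) ((volume.restrict A).prod volume) :=
          hzA.mul_bdd (c := D) (by fun_prop) (Filter.Eventually.of_forall fun p => hD _)
        have e : ∀ y, ψ y • ∫ x in A, z (x, y) = ∫ x in A, z (x, y) * ψ y := by
          intro y
          rw [integral_mul_const, smul_eq_mul, mul_comm]
        simp_rw [e]
        rw [← integral_integral_swap (f := fun x y => z (x, y) * ψ y) hi]
        rw [integral_congr_ae (ae_restrict_of_ae (s1 ψ g1 g2 g3))]
        simp)
    filter_upwards [this] with y hy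
    by_cases hyI : y ∈ Set.Ioo c d
    · exact hy hyI
    · have : ∀ x, z (x, y) = 0 := fun x => hz0 _ (fun h => hyI h.2)
      simp [this]
  have s3 : ∀ A B : Set ℝ, MeasurableSet A → MeasurableSet B → ∫ p in A ×ˢ B, z p = 0 := by
    intro A B hA hB
    have hzAB : Integrable z ((volume.restrict A).prod (volume.restrict B)) := by
      rw [Measure.prod_restrict]; exact hz'.restrict
    rw [Measure.volume_eq_prod, ← Measure.prod_restrict, integral_prod_symm _ hzAB,
      integral_congr_ae (ae_restrict_of_ae (s2 A hA))]
    simp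
  have hu : ∫ p, z p = 0 := by
    have := s3 Set.univ Set.univ .univ .univ
    simpa using this
  refine hz.ae_eq_zero_of_forall_setIntegral_eq_zero fun s hs hfin => ?_
  clear hfin
  induction s, hs using MeasurableSpace.induction_on_inter
    (generateFrom_prod (α := ℝ) (β := ℝ)).symm isPiSystem_prod with
  | empty => simp
  | basic t ht =>
    obtain ⟨A, hA, B, hB, rfl⟩ := ht
    exact s3 A B hA hB
  | compl t ht ih =>
    have := integral_add_compl ht hz
    rw [ih, hu] at this
    linarith
  | iUnion g hd hm ih =>
    rw [integral_iUnion hm hd hz.integrableOn]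
    simp [ih]

/-- Technical lemma (i): a weak partial derivative in X yields, after modification on
a null set, absolute continuity along a.e. horizontal line with derivative f. -/
theorem stmt17 (a b c d : ℝ) (hab : a < b) (hcd : c < d)
    (u f : ℝ × ℝ → ℝ)
    (humeas : Measurable u)
    (hu : ∃ Mb : ℝ, ∀ᵐ p ∂volume, p ∈ Set.Ioo a b ×ˢ Set.Ioo c d → |u p| ≤ Mb)
    (hf : IntegrableOn f (Set.Ioo a b ×ˢ Set.Ioo c d))
    (hweak : ∀ φ : ℝ × ℝ → ℝ, ContDiff ℝ (⊤ : ℕ∞) φ → HasCompactSupport φ →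
      tsupport φ ⊆ Set.Ioo a b ×ˢ Set.Ioo c d →
      ∫ p in Set.Ioo a b ×ˢ Set.Ioo c d,
        (u p * fderiv ℝ φ p (1, 0) + f p * φ p) = 0) :
    ∃ v : ℝ × ℝ → ℝ,
      (∀ᵐ p ∂volume, p ∈ Set.Ioo a b ×ˢ Set.Ioo c d → v p = u p) ∧
      ∀ᵐ Y₀ ∂volume, Y₀ ∈ Set.Ioo c d →
        ∀ X₁ X₂ : ℝ, a < X₁ → X₁ ≤ X₂ → X₂ < b →
          v (X₂, Y₀) - v (X₁, Y₀) = ∫ X in X₁..X₂, f (X, Y₀) := by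
  obtain ⟨Mb, hMb⟩ := hu
  set Γ : Set (ℝ × ℝ) := Set.Ioo a b ×ˢ Set.Ioo c d with hΓdef
  have hΓ : MeasurableSet Γ := measurableSet_Ioo.prod measurableSet_Ioo
  have hΓfin : volume Γ < ⊤ := by
    rw [hΓdef, Measure.volume_eq_prod, Measure.prod_prod, Real.volume_Ioo, Real.volume_Ioo]
    exact ENNReal.mul_lt_top ENNReal.ofReal_lt_top ENNReal.ofReal_lt_top
  -- a measurable representative of f, extended by zero
  obtain ⟨f₀, hf₀m, hf₀i, hf₀f⟩ : ∃ f₀ : ℝ × ℝ → ℝ, StronglyMeasurable f₀ ∧ Integrable f₀ ∧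
      ∀ᵐ p ∂volume, f₀ p = Γ.indicator f p := by
    refine ⟨Γ.indicator (hf.aestronglyMeasurable.mk f),
      hf.aestronglyMeasurable.stronglyMeasurable_mk.indicator hΓ,
      (integrable_indicator_iff hΓ).2 (hf.congr hf.aestronglyMeasurable.ae_eq_mk), ?_⟩
    have := (ae_restrict_iff' hΓ).1 hf.aestronglyMeasurable.ae_eq_mk
    filter_upwards [this] with p hp
    by_cases h : p ∈ Γ
    · simp [h, hp h]
    · simp [h]
  have hf₀i' : Integrable f₀ (volume.prod volume) := hf₀i
  let F : ℝ × ℝ → ℝ := fun p => ∫ s in Set.Iic p.1, f₀ (s, p.2)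
  have hFm : StronglyMeasurable F := by
    have : F = fun p => ∫ s, {q : (ℝ × ℝ) × ℝ | q.2 ≤ q.1.1}.indicator
        (fun q => f₀ (q.2, q.1.2)) (p, s) := by
      ext p
      show ∫ s in Set.Iic p.1, f₀ (s, p.2) = _
      rw [← integral_indicator measurableSet_Iic]
      congr 1
    rw [this]
    apply StronglyMeasurable.integral_prod_right'
    apply StronglyMeasurable.indicator
    · exact hf₀m.comp_measurable (by fun_prop)
    · exact measurableSet_le (by fun_prop) (by fun_prop)
  have hI1 : Integrable ((Set.Ioo a b).indicator (fun _ : ℝ => (1 : ℝ))) :=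
    (integrable_indicator_iff measurableSet_Ioo).2 (integrableOn_const (by simp))
  have hu₀i : Integrable (Γ.indicator u) := by
    rw [integrable_indicator_iff hΓ]
    refine IntegrableOn.of_bound hΓfin humeas.aestronglyMeasurable Mb ?_
    rw [ae_restrict_iff' hΓ]
    exact hMb
  have hF₀i : Integrable (Γ.indicator F) := by
    have hN := hf₀i'.integral_norm_prod_right
    have hdom := hI1.mul_prod hN
    refine Integrable.mono' hdom (hFm.indicator hΓ).aestronglyMeasurable ?_
    have h1 := Measure.quasiMeasurePreserving_snd (μ := (volume : Measure ℝ))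
      (ν := (volume : Measure ℝ)) |>.ae hf₀i'.prod_left_ae
    filter_upwards [h1] with p hp
    by_cases h : p ∈ Γ
    · have h1 : p.1 ∈ Set.Ioo a b := h.1
      simp only [h, Set.indicator_of_mem, h1, one_mul]
      refine (norm_integral_le_integral_norm _).trans ?_
      exact setIntegral_le_integral hp.norm (Filter.Eventually.of_forall fun _ => norm_nonneg _)
    · rw [Set.indicator_of_notMem h, norm_zero]
      refine mul_nonneg (Set.indicator_nonneg (fun _ _ => zero_le_one) _)
        (integral_nonneg fun _ => norm_nonneg _)
  let w : ℝ × ℝ → ℝ := fun p => Γ.indicator u p - Γ.indicator F p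
  have hwi : Integrable w := hu₀i.sub hF₀i
  have hwi' : Integrable w (volume.prod volume) := hwi
  have hw0 : ∀ p, p ∉ Γ → w p = 0 := fun p hp => by simp [w, hp]
  have key : ∀ Φ ψ : ℝ → ℝ, ContDiff ℝ (⊤ : ℕ∞) Φ → HasCompactSupport Φ →
      tsupport Φ ⊆ Set.Ioo a b → ContDiff ℝ (⊤ : ℕ∞) ψ → HasCompactSupport ψ →
      tsupport ψ ⊆ Set.Ioo c d → ∫ p, w p * (deriv Φ p.1 * ψ p.2) = 0 := by
    intro Φ ψ h1 h2 h3 k1 k2 k3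
    have hΦ1 : ContDiff ℝ 1 Φ := h1.of_le (by exact_mod_cast le_top)
    have hdc : Continuous (deriv Φ) := hΦ1.continuous_deriv le_rfl
    have hsub : tsupport (fun p : ℝ × ℝ => Φ p.1 * ψ p.2) ⊆ tsupport Φ ×ˢ tsupport ψ := by
      apply closure_minimal _ ((isClosed_tsupport _).prod (isClosed_tsupport _))
      intro p hp
      have hp' : Φ p.1 * ψ p.2 ≠ 0 := hp
      exact ⟨subset_tsupport _ (left_ne_zero_of_mul hp'),
        subset_tsupport _ (right_ne_zero_of_mul hp')⟩
    have W := hweak (fun p => Φ p.1 * ψ p.2) (by fun_prop)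
      ((h2.isCompact.prod k2.isCompact).of_isClosed_subset (isClosed_tsupport _) hsub)
      (hsub.trans (Set.prod_mono h3 k3))
    have hfd : ∀ p : ℝ × ℝ, fderiv ℝ (fun p : ℝ × ℝ => Φ p.1 * ψ p.2) p (1, 0)
        = deriv Φ p.1 * ψ p.2 := by
      intro p
      have dΦ : HasFDerivAt (fun p : ℝ × ℝ => Φ p.1)
          ((ContinuousLinearMap.toSpanSingleton ℝ (deriv Φ p.1)).comp
            (ContinuousLinearMap.fst ℝ ℝ ℝ)) p :=
        ((hΦ1.differentiable one_ne_zero p.1).hasDerivAt.hasFDerivAt).comp p hasFDerivAt_fst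
      have dψ : HasFDerivAt (fun p : ℝ × ℝ => ψ p.2)
          ((ContinuousLinearMap.toSpanSingleton ℝ (deriv ψ p.2)).comp
            (ContinuousLinearMap.snd ℝ ℝ ℝ)) p :=
        ((k1.differentiable (by simp) p.2).hasDerivAt.hasFDerivAt).comp p hasFDerivAt_snd
      refine (congrArg (fun L : ℝ × ℝ →L[ℝ] ℝ => L (1, 0)) (dΦ.mul dψ).fderiv).trans ?_
      simp [mul_comm]
    simp_rw [hfd] at W
    rw [← integral_indicator hΓ] at W
    have I1 := aux_int_mul hu₀i hdc h2.deriv k1.continuous k2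
    have I2 := aux_int_mul hF₀i hdc h2.deriv k1.continuous k2
    have I3 := aux_int_mul hf₀i h1.continuous h2 k1.continuous k2
    have W2 : ∫ p, (Γ.indicator u p * (deriv Φ p.1 * ψ p.2) + f₀ p * (Φ p.1 * ψ p.2)) = 0 := by
      rw [← W]
      apply integral_congr_ae
      filter_upwards [hf₀f] with p hp
      rw [hp]
      by_cases h : p ∈ Γ <;> simp [h]
    rw [integral_add I1 I3] at W2
    have W3 : ∫ p, Γ.indicator F p * (deriv Φ p.1 * ψ p.2) = - ∫ p, f₀ p * (Φ p.1 * ψ p.2) := by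
      rw [Measure.volume_eq_prod, integral_prod_symm _ I2, integral_prod_symm _ I3,
        ← integral_neg]
      apply integral_congr_ae
      filter_upwards [hf₀i'.prod_left_ae] with y hy
      have e1 : ∀ x, Γ.indicator F (x, y) * (deriv Φ x * ψ y) =
          ((∫ s in Set.Iic x, f₀ (s, y)) * deriv Φ x) * ψ y := by
        intro x
        by_cases h : (x, y) ∈ Γ
        · simp [h, F, mul_assoc]
        · have : deriv Φ x * ψ y = 0 := by
            by_contra hne
            apply h
            exact ⟨h3 (support_deriv_subset (left_ne_zero_of_mul hne)),
              k3 (subset_tsupport _ (right_ne_zero_of_mul hne))⟩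
          rw [mul_assoc, this]; simp
      simp only [e1]
      rw [integral_mul_const, aux_ibp hy hΦ1 h2, neg_mul, ← integral_mul_const]
      simp only [mul_assoc]
    simp only [w, sub_mul]
    rw [integral_sub I1 I2, W3]
    linarith
  -- normalized bump
  obtain ⟨η, e1, e2, e3, e4⟩ : ∃ η : ℝ → ℝ, ContDiff ℝ (⊤ : ℕ∞) η ∧ HasCompactSupport η ∧
      tsupport η ⊆ Set.Ioo a b ∧ ∫ x, η x = 1 := by
    let B : ContDiffBump ((a + b) / 2) := ⟨(b - a) / 8, (b - a) / 4, by linarith, by linarith⟩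
    refine ⟨B.normed volume, B.contDiff_normed, B.hasCompactSupport_normed, ?_, B.integral_normed⟩
    rw [B.tsupport_normed_eq, Real.closedBall_eq_Icc]
    intro x hx
    have h1 : (a + b) / 2 - (b - a) / 4 ≤ x := hx.1
    have h2 : x ≤ (a + b) / 2 + (b - a) / 4 := hx.2
    constructor <;> linarith
  have hηi : Integrable η := e1.continuous.integrable_of_hasCompactSupport e2
  let g : ℝ → ℝ := fun y => ∫ x, w (x, y) * η x
  have hgi : Integrable g := by
    obtain ⟨D, hD⟩ := e2.exists_bound_of_continuous e1.continuous
    have hc := e1.continuous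
    have hi : Integrable (fun p : ℝ × ℝ => w p * η p.1) (volume.prod volume) :=
      hwi'.mul_bdd (c := D) (by fun_prop) (Filter.Eventually.of_forall fun p => hD _)
    exact hi.integral_prod_right
  have hg0 : ∀ y, y ∉ Set.Ioo c d → g y = 0 := by
    intro y hy
    have : ∀ x, w (x, y) = 0 := fun x => hw0 _ fun h => hy h.2
    simp [g, this]
  let G : ℝ × ℝ → ℝ := fun p => (Set.Ioo a b).indicator (fun _ : ℝ => (1 : ℝ)) p.1 * g p.2
  have hGi : Integrable G := hI1.mul_prod hgi
  have hzero : (fun p => w p - G p) =ᵐ[volume] 0 := by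
    refine aux_C (a := a) (b := b) (c := c) (d := d) (hwi.sub hGi) ?_ ?_
    · intro p hp
      have : G p = 0 := by
        by_cases h1 : p.1 ∈ Set.Ioo a b
        · simp [G, hg0 p.2 fun h2 => hp ⟨h1, h2⟩]
        · simp only [G, Set.indicator_of_notMem h1, zero_mul]
      rw [hw0 p hp, this, sub_zero]
    · intro h ψ h1 h2 h3 k1 k2 k3
      have hhi : Integrable h := h1.continuous.integrable_of_hasCompactSupport h2
      obtain ⟨Φ, p1, p2, p3, p4⟩ := aux_prim (h := fun x => h x - (∫ t, h t) * η x) hab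
        (by fun_prop) (h2.sub (e2.mul_left (f := fun _ => ∫ t, h t))) (by
          refine (tsupport_sub _ _).trans (Set.union_subset h3 ?_)
          exact (closure_mono fun x hx => right_ne_zero_of_mul hx).trans e3)
        (by rw [integral_sub hhi (hηi.const_mul _), integral_const_mul, e4]; ring)
      have K := key Φ ψ p1 p2 p3 k1 k2 k3
      rw [p4] at K
      have I1 := aux_int_mul hwi h1.continuous h2 k1.continuous k2
      have I2 := aux_int_mul hwi e1.continuous e2 k1.continuous k2
      have I3 := aux_int_mul hGi h1.continuous h2 k1.continuous k2
      have K2 : ∫ p, w p * (h p.1 * ψ p.2) = (∫ t, h t) * ∫ p, w p * (η p.1 * ψ p.2) := by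
        rw [← integral_const_mul, ← sub_eq_zero, ← integral_sub I1 (I2.const_mul _), ← K]
        congr 1; ext p; ring
      have K3 : ∫ p, w p * (η p.1 * ψ p.2) = ∫ y, g y * ψ y := by
        rw [Measure.volume_eq_prod, integral_prod_symm _ I2]
        congr 1; ext y
        simp only [g]
        rw [← integral_mul_const]
        congr 1; ext x; ring
      have K4 : ∫ p, G p * (h p.1 * ψ p.2) = (∫ t, h t) * ∫ y, g y * ψ y := by
        rw [Measure.volume_eq_prod, ← integral_prod_mul]
        congr 1; ext p
        by_cases hp : p.1 ∈ Set.Ioo a b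
        · simp only [G, Set.indicator_of_mem hp]; ring
        · have : h p.1 = 0 := image_eq_zero_of_notMem_tsupport fun h' => hp (h3 h')
          simp [this]
      simp only [sub_mul]
      rw [integral_sub I1 I3, K2, K3, K4, sub_self]
  refine ⟨fun p => F p + g p.2, ?_, ?_⟩
  · filter_upwards [hzero] with p hp hpΓ
    have h1 : p.1 ∈ Set.Ioo a b := hpΓ.1
    simp only [w, G, Set.indicator_of_mem hpΓ, Set.indicator_of_mem h1, Pi.zero_apply] at hp
    linarith
  · have hs : ∀ᵐ y : ℝ, ∀ᵐ x : ℝ, f₀ (x, y) = Γ.indicator f (x, y) := by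
      have h1 : ∀ᵐ q : ℝ × ℝ ∂(volume.prod volume), f₀ q.swap = Γ.indicator f q.swap :=
        (Measure.measurePreserving_swap (μ := (volume : Measure ℝ))
          (ν := (volume : Measure ℝ))).quasiMeasurePreserving.ae hf₀f
      exact Measure.ae_ae_of_ae_prod h1
    filter_upwards [hs, hf₀i'.prod_left_ae] with y hy hyi hyJ X₁ X₂ h1 h12 h2
    have : F (X₂, y) - F (X₁, y) = ∫ X in X₁..X₂, f₀ (X, y) :=
      intervalIntegral.integral_Iic_sub_Iic hyi.integrableOn hyi.integrableOn
    rw [add_sub_add_right_eq_sub, this]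
    apply intervalIntegral.integral_congr_ae
    filter_upwards [hy] with x hx hxm
    rw [Set.uIoc_of_le h12] at hxm
    rw [hx, Set.indicator_of_mem]
    exact ⟨⟨h1.trans hxm.1, hxm.2.trans_lt h2⟩, hyJ⟩
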